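/- (Product estimate in negative Sobolev space) For f, g Schwartz functions on ℝ³ one has ‖f·g‖_{H^{-1}_{3/2}} ≲ ‖f‖_{H^1_3}·‖g‖_{H^{-1}_3}, where H^s_p denotes the Bessel-potential Sobolev space on ℝ³. -/

import Mathlib

open MeasureTheory Real
open scoped FourierTransform ENNReal

/-- The Bessel-potential Sobolev (quasi-)norm `‖⟨∇⟩ˢ f‖_{L^p}` on ℝ³, defined
via the Fourier multiplier with symbol `(1 + |ξ|²)^{s/2}`. -/
noncomputable def besselNorm (s : ℝ) (p : ℝ≥0∞)
    (f : EuclideanSpace ℝ (Fin 3) → ℂ) : ℝ≥0∞ :=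
  eLpNorm (𝓕⁻ fun ξ => (((1 + ‖ξ‖ ^ 2) ^ (s / 2) : ℝ) : ℂ) * 𝓕 f ξ) p volume


/-- **Minkowski's integral inequality**, for a family of functions with uniformly bounded `L^p`
norms weighted by an integrable coefficient. -/
theorem eLpNorm_le_of_enorm_le_lintegral {A X : Type*} [MeasurableSpace A] [MeasurableSpace X]
    {ν : Measure A} [SFinite ν] {μ : Measure X} [SFinite μ] {p : ℝ≥0∞} (hp : 1 ≤ p) (hp' : p ≠ ∞)
    {c : A → ℂ} (hc : Measurable c) {F : A → X → ℂ} (hF : Measurable (Function.uncurry F))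
    {B : ℝ≥0∞} (hB : ∀ a, eLpNorm (F a) p μ ≤ B) {Φ : X → ℂ}
    (hΦ : ∀ x, ‖Φ x‖ₑ ≤ ∫⁻ a, ‖c a‖ₑ * ‖F a x‖ₑ ∂ν) :
    eLpNorm Φ p μ ≤ (∫⁻ a, ‖c a‖ₑ ∂ν) * B := by
  have hp0 : p ≠ 0 := (zero_lt_one.trans_le hp).ne'
  set r := p.toReal with hr
  have hr1 : 1 ≤ r := by
    rw [hr, ← ENNReal.toReal_one]; exact ENNReal.toReal_mono hp' hp
  have hr0 : 0 < r := by linarith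
  set M := ∫⁻ a, ‖c a‖ₑ ∂ν with hM
  set ν' := ν.withDensity (fun a => ‖c a‖ₑ) with hν'
  have hMν : ν' Set.univ = M := by simp [hν', hM]
  have hFx : ∀ x, Measurable fun a => F a x := fun x =>
    hF.comp (measurable_id.prodMk measurable_const)
  have hpow : ∀ x, ‖Φ x‖ₑ ^ r ≤ M ^ (r - 1) * ∫⁻ a, ‖F a x‖ₑ ^ r ∂ν' := by
    intro x
    have h1 : ‖Φ x‖ₑ ≤ eLpNorm (fun a => F a x) 1 ν' := by
      rw [eLpNorm_one_eq_lintegral_enorm, hν',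
        lintegral_withDensity_eq_lintegral_mul _ hc.enorm (hFx x).enorm]
      exact hΦ x
    have h2 := eLpNorm_le_eLpNorm_mul_rpow_measure_univ hp
      (hFx x).aestronglyMeasurable (μ := ν')
    refine (ENNReal.rpow_le_rpow (h1.trans h2) hr0.le).trans ?_
    rw [ENNReal.mul_rpow_of_nonneg _ _ hr0.le, ← ENNReal.rpow_mul, hMν,
      eLpNorm_eq_lintegral_rpow_enorm_toReal hp0 hp', ← ENNReal.rpow_mul, ← hr]
    have e1 : 1 / r * r = 1 := by field_simp
    have e2 : (1 / (1 : ℝ≥0∞).toReal - 1 / r) * r = r - 1 := by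
      simp; field_simp
    rw [e1, e2, ENNReal.rpow_one, mul_comm]
  have hint : ∫⁻ x, ‖Φ x‖ₑ ^ r ∂μ ≤ (M * B) ^ r := by
    calc ∫⁻ x, ‖Φ x‖ₑ ^ r ∂μ
        ≤ ∫⁻ x, M ^ (r - 1) * ∫⁻ a, ‖F a x‖ₑ ^ r ∂ν' ∂μ := lintegral_mono hpow
      _ = M ^ (r - 1) * ∫⁻ a, ∫⁻ x, ‖F a x‖ₑ ^ r ∂μ ∂ν' := by
          have hm : Measurable (Function.uncurry fun (x : X) (a : A) => ‖F a x‖ₑ ^ r) :=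
            ((hF.comp measurable_swap).enorm).pow_const _
          have hm' : Measurable fun x => ∫⁻ a, ‖F a x‖ₑ ^ r ∂ν' := hm.lintegral_prod_right'
          rw [lintegral_const_mul _ hm', lintegral_lintegral_swap hm.aemeasurable]
      _ ≤ M ^ (r - 1) * ∫⁻ _, B ^ r ∂ν' := by
          gcongr with a
          have := ENNReal.rpow_le_rpow (hB a) hr0.le
          rwa [eLpNorm_eq_lintegral_rpow_enorm_toReal hp0 hp', ← ENNReal.rpow_mul, ← hr,
            one_div, inv_mul_cancel₀ hr0.ne', ENNReal.rpow_one] at this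
      _ = (M * B) ^ r := by
          have e : M ^ r = M ^ (r - 1) * M := by
            conv_rhs => rw [← ENNReal.rpow_one M, ← ENNReal.rpow_mul, one_mul]
            rw [← ENNReal.rpow_add_of_nonneg _ _ (by linarith) zero_le_one]
            simp
          rw [lintegral_const, hMν, ENNReal.mul_rpow_of_nonneg _ _ hr0.le, e]
          ring
  rw [eLpNorm_eq_lintegral_rpow_enorm_toReal hp0 hp', ← hr]
  refine (ENNReal.rpow_le_rpow hint (by positivity)).trans ?_
  rw [← ENNReal.rpow_mul, mul_one_div, div_self hr0.ne', ENNReal.rpow_one]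

theorem integrableOn_rpow_mul_exp_neg_mul {a r : ℝ} (ha : 0 < a) (hr : 0 < r) :
    IntegrableOn (fun t : ℝ => t ^ (a - 1) * rexp (-(r * t))) (Set.Ioi 0) := by
  refine .of_integral_ne_zero ?_
  rw [integral_rpow_mul_exp_neg_mul_Ioi ha hr]
  have := Real.Gamma_pos_of_pos ha
  positivity

theorem integral_rpow_neg_half_mul_exp {S : ℝ} (hS : 0 < S) :
    ∫ t in Set.Ioi (0 : ℝ), t ^ (-1 / 2 : ℝ) * rexp (-(S * t)) = √π * S ^ (-1 / 2 : ℝ) := by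
  have := integral_rpow_mul_exp_neg_mul_Ioi (a := 1 / 2) (by norm_num) hS
  rw [Real.Gamma_one_half_eq] at this
  norm_num at this ⊢
  rw [this, Real.inv_rpow hS.le, ← Real.rpow_neg hS.le, mul_comm]

theorem exp_sub_exp_bounds {S t : ℝ} (hS : 1 ≤ S) (ht : 0 ≤ t) :
    0 ≤ rexp (-t) - rexp (-(S * t)) ∧
      rexp (-t) - rexp (-(S * t)) ≤ (S - 1) * t * rexp (-t) := by
  have h : rexp (-(S * t)) = rexp (-t) * rexp (-((S - 1) * t)) := by
    rw [← Real.exp_add]; ring_nf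
  have h1 := Real.add_one_le_exp (-((S - 1) * t))
  have h2 : rexp (-((S - 1) * t)) ≤ 1 := Real.exp_le_one_iff.2 (by nlinarith)
  have h3 := Real.exp_pos (-t)
  rw [h]
  constructor <;> nlinarith

theorem integrableOn_exp_sub_exp {S : ℝ} (hS : 1 ≤ S) :
    IntegrableOn (fun t : ℝ => t ^ (-3 / 2 : ℝ) * (rexp (-t) - rexp (-(S * t))))
      (Set.Ioi 0) := by
  have h := (integrableOn_rpow_mul_exp_neg_mul (a := 1 / 2) (r := 1) (by norm_num)
    (by norm_num)).const_mul (S - 1)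
  refine Integrable.mono' h ?_ ?_
  · exact Measurable.aestronglyMeasurable (by fun_prop)
  · filter_upwards [ae_restrict_mem measurableSet_Ioi] with t ht
    have ht : 0 < t := ht
    obtain ⟨h1, h2⟩ := exp_sub_exp_bounds hS ht.le
    rw [Real.norm_of_nonneg (by positivity)]
    have e : t ^ (1 / 2 - 1 : ℝ) = t ^ (-3 / 2 : ℝ) * t := by
      rw [← Real.rpow_add_one ht.ne']; norm_num
    rw [e, one_mul]
    calc _ ≤ t ^ (-3 / 2 : ℝ) * ((S - 1) * t * rexp (-t)) := by gcongr
      _ = _ := by ring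

theorem integral_exp_sub_exp {S : ℝ} (hS : 1 ≤ S) :
    ∫ t in Set.Ioi (0 : ℝ), t ^ (-3 / 2 : ℝ) * (rexp (-t) - rexp (-(S * t))) =
      2 * √π * (S ^ (1 / 2 : ℝ) - 1) := by
  have hS0 : 0 < S := by linarith
  have i1 := integrableOn_rpow_mul_exp_neg_mul (a := 1 / 2) (r := 1) (by norm_num) (by norm_num)
  have iS := integrableOn_rpow_mul_exp_neg_mul (a := 1 / 2) (r := S) (by norm_num) hS0
  norm_num at i1 iS
  have i3 := integrableOn_exp_sub_exp hS
  set φ : ℝ → ℝ := fun t => t ^ (-1 / 2 : ℝ) * (rexp (-t) - rexp (-(S * t))) with hφ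
  have hφb : ∀ t, 0 ≤ t → ‖φ t‖ ≤ (S - 1) * (t ^ (1 / 2 : ℝ) * rexp (-t)) := by
    intro t ht
    obtain ⟨h1, h2⟩ := exp_sub_exp_bounds hS ht
    rw [hφ, Real.norm_of_nonneg (by positivity)]
    rcases ht.eq_or_lt with rfl | ht
    · simp
    have e : t ^ (1 / 2 : ℝ) = t ^ (-1 / 2 : ℝ) * t := by
      rw [← Real.rpow_add_one ht.ne']; norm_num
    rw [e]
    refine (mul_le_mul_of_nonneg_left h2 (by positivity)).trans_eq ?_
    ring
  have hcont : ContinuousWithinAt φ (Set.Ici 0) 0 := by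
    have h0 : φ 0 = 0 := by simp [hφ]
    rw [ContinuousWithinAt, h0]
    refine squeeze_zero_norm' (a := fun t => (S - 1) * (t ^ (1 / 2 : ℝ) * rexp (-t))) ?_ ?_
    · filter_upwards [self_mem_nhdsWithin] with t ht using hφb t ht
    · have : Continuous fun t : ℝ => (S - 1) * (t ^ (1 / 2 : ℝ) * rexp (-t)) := by
        have := Real.continuous_rpow_const (q := 1 / 2) (by norm_num)
        fun_prop
      have := this.tendsto 0
      norm_num at this
      norm_num
      exact this.mono_left nhdsWithin_le_nhds
  have hlim : Filter.Tendsto φ Filter.atTop (nhds 0) := by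
    refine squeeze_zero_norm' (a := fun t => (S - 1) * (t ^ (1 / 2 : ℝ) * rexp (-t))) ?_ ?_
    · filter_upwards [Filter.eventually_ge_atTop 0] with t ht using hφb t ht
    · have := (tendsto_rpow_mul_exp_neg_mul_atTop_nhds_zero (1 / 2) 1 zero_lt_one).const_mul (S - 1)
      simpa using this
  have hderiv : ∀ t ∈ Set.Ioi (0 : ℝ), HasDerivAt φ
      (-(1 / 2) * (t ^ (-3 / 2 : ℝ) * (rexp (-t) - rexp (-(S * t)))) +
        (S * (t ^ (-1 / 2 : ℝ) * rexp (-(S * t))) - t ^ (-1 / 2 : ℝ) * rexp (-t))) t := by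
    intro t ht
    have h1 := Real.hasDerivAt_rpow_const (x := t) (p := -1 / 2) (Or.inl (ne_of_gt ht))
    have h2 : HasDerivAt (fun t => rexp (-t)) (rexp (-t) * (-1)) t := (hasDerivAt_neg t).exp
    have h3 : HasDerivAt (fun t => rexp (-(S * t))) (rexp (-(S * t)) * (-(S * 1))) t :=
      (((hasDerivAt_id t).const_mul S).neg).exp
    refine (h1.mul (h2.sub h3)).congr_deriv ?_
    norm_num
    ring
  have i1' : IntegrableOn (fun t : ℝ => t ^ (-1 / 2 : ℝ) * rexp (-t)) (Set.Ioi 0) := by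
    convert i1 using 3; norm_num
  have iS' : IntegrableOn (fun t : ℝ => t ^ (-1 / 2 : ℝ) * rexp (-(S * t))) (Set.Ioi 0) := by
    convert iS using 3; norm_num
  have key := integral_Ioi_of_hasDerivAt_of_tendsto hcont hderiv
    ((i3.const_mul _).add ((iS'.const_mul S).sub i1')) hlim
  rw [integral_add (i3.const_mul _) (g := fun t => S * (t ^ (-1 / 2 : ℝ) * rexp (-(S * t))) -
      t ^ (-1 / 2 : ℝ) * rexp (-t)) ((iS'.const_mul S).sub i1'),
    integral_sub (iS'.const_mul S) i1', integral_const_mul, integral_const_mul,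
    integral_rpow_neg_half_mul_exp hS0] at key
  have k1 := integral_rpow_neg_half_mul_exp one_pos
  simp only [one_mul, Real.one_rpow, mul_one] at k1
  have h0 : φ 0 = 0 := by simp [hφ]
  have e : S ^ (1 / 2 : ℝ) = S * S ^ (-1 / 2 : ℝ) := by
    rw [mul_comm, ← Real.rpow_add_one hS0.ne']; norm_num
  rw [k1, h0] at key
  rw [e]
  linarith

/-- The character `x ↦ exp(2πi⟨x, ξ⟩)` of `ℝ³`. -/
noncomputable def phase (x ξ : EuclideanSpace ℝ (Fin 3)) : ℂ :=
  Complex.exp (((2 * π * inner ℝ x ξ : ℝ) : ℂ) * Complex.I)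

theorem norm_phase (x ξ : EuclideanSpace ℝ (Fin 3)) : ‖phase x ξ‖ = 1 := by
  rw [phase, Complex.norm_exp_ofReal_mul_I]

theorem phase_add_left (x y ξ : EuclideanSpace ℝ (Fin 3)) :
    phase (x + y) ξ = phase x ξ * phase y ξ := by
  rw [phase, phase, phase, ← Complex.exp_add, inner_add_left]
  push_cast
  ring_nf

theorem phase_add_right (x ξ η : EuclideanSpace ℝ (Fin 3)) :
    phase x (ξ + η) = phase x ξ * phase x η := by
  rw [phase, phase, phase, ← Complex.exp_add, inner_add_right]
  push_cast
  ring_nf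

theorem phase_neg_left (x ξ : EuclideanSpace ℝ (Fin 3)) : phase (-x) ξ = phase x (-ξ) := by
  simp [phase]

theorem continuous_phase : Continuous (Function.uncurry phase) := by
  unfold phase Function.uncurry
  fun_prop

theorem Continuous.phase {X : Type*} [TopologicalSpace X]
    {f g : X → EuclideanSpace ℝ (Fin 3)} (hf : Continuous f) (hg : Continuous g) :
    Continuous fun x => phase (f x) (g x) :=
  continuous_phase.comp (hf.prodMk hg)

theorem norm_one_sub_phase_le (x ξ : EuclideanSpace ℝ (Fin 3)) :
    ‖1 - phase x ξ‖ ≤ 2 * π * (‖x‖ * ‖ξ‖) := by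
  rw [phase, norm_sub_rev, mul_comm _ Complex.I]
  refine (Real.norm_exp_I_mul_ofReal_sub_one_le).trans ?_
  rw [norm_mul, Real.norm_of_nonneg (by positivity)]
  gcongr
  exact norm_inner_le_norm x ξ

theorem integral_phase_stdGaussian (s : ℝ) (ξ : EuclideanSpace ℝ (Fin 3)) :
    ∫ z, phase (s • z) ξ ∂ProbabilityTheory.stdGaussian (EuclideanSpace ℝ (Fin 3)) =
      ((rexp (-(2 * π ^ 2 * s ^ 2 * ‖ξ‖ ^ 2)) : ℝ) : ℂ) := by
  have h := ProbabilityTheory.charFun_stdGaussian ((2 * π * s) • ξ)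
  rw [charFun_apply] at h
  have e : ∀ z : EuclideanSpace ℝ (Fin 3), phase (s • z) ξ =
      Complex.exp ((inner ℝ z ((2 * π * s) • ξ) : ℝ) * Complex.I) := by
    intro z
    rw [phase, inner_smul_left, inner_smul_right]
    simp [mul_assoc]
  simp_rw [e]
  rw [h, norm_smul, Complex.ofReal_exp]
  congr 1
  push_cast
  rw [← Complex.ofReal_pow, ← Complex.ofReal_pow, ← Complex.ofReal_pow, mul_pow,
    ← Complex.ofReal_pow]
  rw [Real.norm_eq_abs, sq_abs]
  push_cast
  ring

/-- A measure `μ` on `ℝ³` representing the carré du champ of `⟨∇⟩`. -/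
theorem exists_levyMeasure : ∃ μ : Measure (EuclideanSpace ℝ (Fin 3)), SFinite μ ∧
    Integrable (fun h => ‖h‖ ^ (3 / 2 : ℝ)) μ ∧ Integrable (fun h => ‖h‖ ^ (2 : ℝ)) μ ∧
    ∀ ξ η : EuclideanSpace ℝ (Fin 3), ∫ h, (1 - phase (-h) ξ) * (1 - phase h η) ∂μ =
      (((1 + ‖ξ‖ ^ 2) ^ (1 / 2 : ℝ) + (1 + ‖η‖ ^ 2) ^ (1 / 2 : ℝ) -
        (1 + ‖ξ - η‖ ^ 2) ^ (1 / 2 : ℝ) - 1 : ℝ) : ℂ) := by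
  set γ := ProbabilityTheory.stdGaussian (EuclideanSpace ℝ (Fin 3)) with hγ
  set d : ℝ → NNReal := fun t => Real.toNNReal ((2 * √π)⁻¹ * (t ^ (-3 / 2 : ℝ) * rexp (-t))) with hd
  have hdm : Measurable d := by fun_prop
  set ν := (volume.restrict (Set.Ioi (0 : ℝ))).withDensity (fun t => (d t : ℝ≥0∞)) with hν
  set H : ℝ × EuclideanSpace ℝ (Fin 3) → EuclideanSpace ℝ (Fin 3) :=
    fun p => (√(p.1 / 2) / π) • p.2 with hH
  have hHm : Measurable H := by fun_prop
  have hdt : ∀ t : ℝ, 0 < t → (d t : ℝ) = (2 * √π)⁻¹ * (t ^ (-3 / 2 : ℝ) * rexp (-t)) :=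
    fun t ht => Real.coe_toNNReal _ (by positivity)
  have hmom : ∀ q : ℝ, 1 < q → Integrable (fun h => ‖h‖ ^ q) ((ν.prod γ).map H) := by
    intro q hq
    rw [integrable_map_measure (Measurable.aestronglyMeasurable (by fun_prop)) hHm.aemeasurable]
    have h1 : Integrable (fun t : ℝ => (√(t / 2) / π) ^ q) ν := by
      rw [hν, integrable_withDensity_iff_integrable_smul hdm]
      have := (integrableOn_rpow_mul_exp_neg_mul (a := q / 2 - 1 / 2) (r := 1) (by linarith)
        (by norm_num)).const_mul ((2 * √π)⁻¹ * (√2 * π) ^ (-q))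
      refine this.congr ?_
      filter_upwards [ae_restrict_mem measurableSet_Ioi] with t ht
      have ht : 0 < t := ht
      rw [NNReal.smul_def, hdt t ht, smul_eq_mul, Real.sqrt_div ht.le, div_div,
        Real.div_rpow (by positivity) (by positivity), Real.sqrt_eq_rpow t, ← Real.rpow_mul ht.le,
        show q / 2 - 1 / 2 - 1 = (-3 / 2) + 1 / 2 * q by ring, Real.rpow_add ht,
        Real.rpow_neg (by positivity), one_mul]
      ring
    have h2 : Integrable (fun z => ‖z‖ ^ q) γ := by
      have := (ProbabilityTheory.IsGaussian.memLp_id γ (ENNReal.ofReal q)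
        ENNReal.ofReal_ne_top).integrable_norm_rpow'
      rwa [ENNReal.toReal_ofReal (by linarith)] at this
    refine (h1.mul_prod h2).congr (ae_of_all _ fun p => ?_)
    simp only [Function.comp, hH, norm_smul]
    rw [Real.norm_of_nonneg (by positivity), Real.mul_rpow (by positivity) (by positivity)]
  refine ⟨(ν.prod γ).map H, inferInstance, hmom _ (by norm_num), hmom _ (by norm_num), ?_⟩
  intro ξ η
  have hcm : Continuous fun h => (1 - phase (-h) ξ) * (1 - phase h η) := by
    have h1 := continuous_neg.phase (continuous_const (y := ξ))
    have h2 := continuous_id.phase (continuous_const (y := η))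
    simp only [id] at h2
    fun_prop
  have hint : Integrable (fun h => (1 - phase (-h) ξ) * (1 - phase h η)) ((ν.prod γ).map H) := by
    refine ((hmom 2 (by norm_num)).const_mul ((2 * π) ^ 2 * (‖ξ‖ * ‖η‖))).mono'
      hcm.aestronglyMeasurable (ae_of_all _ fun h => ?_)
    rw [norm_mul]
    have := mul_le_mul (norm_one_sub_phase_le (-h) ξ) (norm_one_sub_phase_le h η)
      (norm_nonneg _) (by positivity)
    rw [norm_neg] at this
    refine this.trans_eq ?_
    rw [Real.rpow_two]
    ring
  rw [integral_map hHm.aemeasurable hcm.aestronglyMeasurable]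
  have hint' := hint.comp_measurable hHm
  simp only [Function.comp_def] at hint'
  rw [integral_prod _ hint']
  have hinner : ∀ t : ℝ, 0 < t →
      ∫ z, (1 - phase (-(H (t, z))) ξ) * (1 - phase (H (t, z)) η) ∂γ =
      ((1 - rexp (-(t * ‖ξ‖ ^ 2)) - rexp (-(t * ‖η‖ ^ 2)) +
        rexp (-(t * ‖ξ - η‖ ^ 2)) : ℝ) : ℂ) := by
    intro t ht
    have hp : ∀ ζ, ∫ z, phase (H (t, z)) ζ ∂γ = ((rexp (-(t * ‖ζ‖ ^ 2)) : ℝ) : ℂ) := by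
      intro ζ
      simp only [hH]
      rw [integral_phase_stdGaussian, div_pow, Real.sq_sqrt (by positivity)]
      congr 3
      field_simp
    have hi : ∀ ζ, Integrable (fun z => phase (H (t, z)) ζ) γ := by
      intro ζ
      refine (integrable_const (1 : ℝ)).mono' ?_ (ae_of_all _ fun z => (norm_phase _ _).le)
      simp only [hH]
      exact (Continuous.phase (by fun_prop) continuous_const).aestronglyMeasurable
    have e : ∀ z, (1 - phase (-(H (t, z))) ξ) * (1 - phase (H (t, z)) η) =
        1 - phase (H (t, z)) (-ξ) - phase (H (t, z)) η + phase (H (t, z)) (-ξ + η) := by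
      intro z
      rw [phase_add_right, phase_neg_left]
      ring
    simp_rw [e]
    have i1 : Integrable (fun z => 1 - phase (H (t, z)) (-ξ)) γ := (integrable_const _).sub (hi _)
    have i2 : Integrable (fun z => 1 - phase (H (t, z)) (-ξ) - phase (H (t, z)) η) γ :=
      i1.sub (hi _)
    rw [integral_add i2 (hi _), integral_sub i1 (hi _), integral_sub (integrable_const _) (hi _),
      hp, hp, hp, norm_neg,
      show -ξ + η = -(ξ - η) by abel, norm_neg]
    simp
  rw [hν, integral_withDensity_eq_integral_smul hdm]
  have e2 : ∀ t ∈ Set.Ioi (0 : ℝ),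
      d t • ∫ z, (1 - phase (-(H (t, z))) ξ) * (1 - phase (H (t, z)) η) ∂γ =
      (((2 * √π)⁻¹ * (t ^ (-3 / 2 : ℝ) * (rexp (-t) - rexp (-((1 + ‖ξ‖ ^ 2) * t))) +
        t ^ (-3 / 2 : ℝ) * (rexp (-t) - rexp (-((1 + ‖η‖ ^ 2) * t))) -
        t ^ (-3 / 2 : ℝ) * (rexp (-t) - rexp (-((1 + ‖ξ - η‖ ^ 2) * t)))) : ℝ) : ℂ) := by
    intro t ht
    have e3 : ∀ s : ℝ, rexp (-((1 + s) * t)) = rexp (-t) * rexp (-(t * s)) := by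
      intro s
      rw [← Real.exp_add]
      ring_nf
    rw [hinner t ht, NNReal.smul_def, hdt t ht, e3, e3, e3, Complex.real_smul,
      ← Complex.ofReal_mul]
    congr 1
    ring
  rw [setIntegral_congr_fun measurableSet_Ioi e2, integral_complex_ofReal, integral_const_mul]
  have hS : ∀ ζ : EuclideanSpace ℝ (Fin 3), 1 ≤ 1 + ‖ζ‖ ^ 2 := fun ζ => by
    nlinarith [sq_nonneg ‖ζ‖]
  rw [integral_sub _ (integrableOn_exp_sub_exp (hS _)), integral_add
    (integrableOn_exp_sub_exp (hS _)) (integrableOn_exp_sub_exp (hS _)),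
    integral_exp_sub_exp (hS _), integral_exp_sub_exp (hS _), integral_exp_sub_exp (hS _)]
  · congr 1
    have : √π ≠ 0 := by positivity
    field_simp
    ring
  · exact (integrableOn_exp_sub_exp (hS _)).add (integrableOn_exp_sub_exp (hS _))

/-- The heat kernel on `ℝ³` with Fourier transform `exp(-t|ξ|²)`. -/
noncomputable def heat (t : ℝ) (y : EuclideanSpace ℝ (Fin 3)) : ℝ :=
  (π / t) ^ (3 / 2 : ℝ) * rexp (-(π ^ 2 / t) * ‖y‖ ^ 2)

theorem heat_nonneg {t : ℝ} (ht : 0 < t) (y : EuclideanSpace ℝ (Fin 3)) : 0 ≤ heat t y := by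
  unfold heat; positivity

theorem integral_phase_mul_heat {t : ℝ} (ht : 0 < t) (ξ : EuclideanSpace ℝ (Fin 3)) :
    ∫ y, phase (-y) ξ * (heat t y : ℂ) = ((rexp (-(t * ‖ξ‖ ^ 2)) : ℝ) : ℂ) := by
  have hb : 0 < ((π ^ 2 / t : ℝ) : ℂ).re := by
    rw [Complex.ofReal_re]; positivity
  have h := fourier_gaussian_innerProductSpace hb ξ
  rw [fourier_eq'] at h
  have e : ∀ y, phase (-y) ξ * (heat t y : ℂ) = (((π / t) ^ (3 / 2 : ℝ) : ℝ) : ℂ) *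
      (Complex.exp (((-2 * π * inner ℝ y ξ : ℝ) : ℂ) * Complex.I) •
        Complex.exp (-((π ^ 2 / t : ℝ) : ℂ) * (‖y‖ : ℂ) ^ 2)) := by
    intro y
    rw [phase, heat, inner_neg_left]
    push_cast
    rw [smul_eq_mul]
    ring_nf
  simp_rw [e]
  rw [integral_const_mul, h, finrank_euclideanSpace_fin]
  have e1 : (π : ℂ) / ((π ^ 2 / t : ℝ) : ℂ) = ((t / π : ℝ) : ℂ) := by
    rw [← Complex.ofReal_div]
    congr 1
    field_simp
  have e2 : (((3 : ℕ) : ℂ) / 2) = ((3 / 2 : ℝ) : ℂ) := by push_cast; rfl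
  rw [e1, e2, ← Complex.ofReal_cpow (by positivity), ← mul_assoc, ← Complex.ofReal_mul,
    ← Real.mul_rpow (by positivity) (by positivity), Complex.ofReal_exp]
  have e3 : π / t * (t / π) = 1 := by field_simp
  rw [e3, Real.one_rpow, Complex.ofReal_one, one_mul]
  congr 1
  push_cast
  have : (t : ℂ) ≠ 0 := by exact_mod_cast ht.ne'
  have : (π : ℂ) ≠ 0 := by exact_mod_cast Real.pi_ne_zero
  field_simp

theorem integral_heat {t : ℝ} (ht : 0 < t) : ∫ y, heat t y = 1 := by
  have h := integral_phase_mul_heat ht 0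
  simp only [phase, inner_zero_right, mul_zero, Complex.ofReal_zero, zero_mul, Complex.exp_zero,
    one_mul, norm_zero, ne_eq, OfNat.ofNat_ne_zero, not_false_eq_true, zero_pow, neg_zero,
    Real.exp_zero] at h
  rw [integral_complex_ofReal] at h
  exact_mod_cast h

theorem integrable_heat {t : ℝ} (ht : 0 < t) : Integrable (heat t) :=
  .of_integral_ne_zero (by rw [integral_heat ht]; exact one_ne_zero)

theorem heat_sub_abs_le {t s : ℝ} (ht : 0 < t) (hs : 0 < s) (h y : EuclideanSpace ℝ (Fin 3)) :
    |heat t (y - h) - heat t y| ≤ (s + 1 / (2 * s)) * (heat t (y - h) + heat t y) -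
      1 / s * rexp (-(π ^ 2 / (4 * t) * ‖h‖ ^ 2)) * heat t (y - (1 / 2 : ℝ) • h) := by
  set r : EuclideanSpace ℝ (Fin 3) → ℝ :=
    fun y => (π / t) ^ (3 / 4 : ℝ) * rexp (-(π ^ 2 / (2 * t)) * ‖y‖ ^ 2) with hr
  have hr0 : ∀ y, 0 ≤ r y := fun y => by positivity
  have hsq : ∀ y, heat t y = r y ^ 2 := by
    intro y
    rw [hr, heat, mul_pow, ← Real.rpow_natCast ((π / t) ^ (3 / 4 : ℝ)) 2,
      ← Real.rpow_mul (by positivity),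
      ← Real.exp_nat_mul]
    congr 2
    · norm_num
    · push_cast; field_simp
  have hmul : r (y - h) * r y =
      rexp (-(π ^ 2 / (4 * t) * ‖h‖ ^ 2)) * heat t (y - (1 / 2 : ℝ) • h) := by
    have hp : ‖y - h‖ ^ 2 + ‖y‖ ^ 2 = 2 * ‖y - (1 / 2 : ℝ) • h‖ ^ 2 + ‖h‖ ^ 2 / 2 := by
      rw [@norm_sub_sq_real, @norm_sub_sq_real, inner_smul_right, norm_smul, Real.norm_eq_abs]
      norm_num
      ring
    have e1 : (π / t) ^ (3 / 2 : ℝ) = (π / t) ^ (3 / 4 : ℝ) * (π / t) ^ (3 / 4 : ℝ) := by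
      rw [← Real.rpow_add (by positivity)]; norm_num
    have e2 : rexp (-(π ^ 2 / (2 * t)) * ‖y - h‖ ^ 2) * rexp (-(π ^ 2 / (2 * t)) * ‖y‖ ^ 2) =
        rexp (-(π ^ 2 / (4 * t) * ‖h‖ ^ 2)) *
          rexp (-(π ^ 2 / t) * ‖y - (1 / 2 : ℝ) • h‖ ^ 2) := by
      rw [← Real.exp_add, ← Real.exp_add, ← mul_add, hp]
      congr 1
      field_simp
      ring
    simp only [hr, heat]
    rw [e1]
    linear_combination (π / t) ^ (3 / 4 : ℝ) * (π / t) ^ (3 / 4 : ℝ) * e2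
  rw [mul_assoc, ← hmul, hsq, hsq]
  set a := r (y - h)
  set b := r y
  have key : |a ^ 2 - b ^ 2| ≤ s / 2 * (a + b) ^ 2 + 1 / (2 * s) * (a - b) ^ 2 := by
    have h1 : 2 * (|a + b| * |a - b|) ≤ s * |a + b| ^ 2 + 1 / s * |a - b| ^ 2 := by
      have : s * |a + b| ^ 2 + 1 / s * |a - b| ^ 2 - 2 * (|a + b| * |a - b|) =
          1 / s * (s * |a + b| - |a - b|) ^ 2 := by field_simp; ring
      have : 0 ≤ 1 / s * (s * |a + b| - |a - b|) ^ 2 := by positivity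
      linarith
    rw [sq_abs, sq_abs, ← abs_mul] at h1
    rw [show a ^ 2 - b ^ 2 = (a + b) * (a - b) by ring]
    have e : 1 / (2 * s) = 1 / s / 2 := by field_simp
    rw [e]
    linarith
  have e : s / 2 * (a + b) ^ 2 + 1 / (2 * s) * (a - b) ^ 2 =
      (s + 1 / (2 * s)) * (a ^ 2 + b ^ 2) - 1 / s * (a * b) - s / 2 * (a - b) ^ 2 := by
    field_simp
    ring
  have : 0 ≤ s / 2 * (a - b) ^ 2 := by positivity
  linarith

theorem integral_abs_heat_sub_le {t : ℝ} (ht : 0 < t) (h : EuclideanSpace ℝ (Fin 3)) :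
    ∫ y, |heat t (y - h) - heat t y| ≤ 5 * (‖h‖ / √t) ^ (3 / 4 : ℝ) := by
  rcases eq_or_ne h 0 with rfl | hh
  · simp
  have ii : ∀ z, Integrable fun y => heat t (y - z) := fun z =>
    (integrable_heat ht).comp_sub_right z
  have iz : ∀ z, ∫ y, heat t (y - z) = 1 := fun z => by
    rw [integral_sub_right_eq_self, integral_heat ht]
  set s := ‖h‖ / √t with hs
  have hs0 : 0 < s := by have := norm_pos_iff.2 hh; positivity
  rcases le_total s 1 with h1 | h1
  · have i1 : Integrable fun y => (s + 1 / (2 * s)) * (heat t (y - h) + heat t y) :=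
      ((ii h).add (integrable_heat ht)).const_mul _
    have i2 : Integrable fun y => 1 / s * rexp (-(π ^ 2 / (4 * t) * ‖h‖ ^ 2)) *
        heat t (y - (1 / 2 : ℝ) • h) := (ii _).const_mul _
    have hle : ∫ y, |heat t (y - h) - heat t y| ≤
        (s + 1 / (2 * s)) * 2 - 1 / s * rexp (-(π ^ 2 / (4 * t) * ‖h‖ ^ 2)) := by
      refine (integral_mono ((ii h).sub (integrable_heat ht)).abs (i1.sub i2)
        (fun y => heat_sub_abs_le ht hs0 h y)).trans_eq ?_
      simp only [Pi.sub_apply]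
      rw [integral_sub i1 i2, integral_const_mul, integral_const_mul,
        integral_add (ii h) (integrable_heat ht), iz, iz, integral_heat ht]
      ring
    have hst : π ^ 2 / (4 * t) * ‖h‖ ^ 2 = π ^ 2 / 4 * s ^ 2 := by
      rw [hs, div_pow, Real.sq_sqrt ht.le]
      field_simp
    rw [hst] at hle
    have hexp := Real.add_one_le_exp (-(π ^ 2 / 4 * s ^ 2))
    have hpi : π ^ 2 / 4 ≤ 3 := by nlinarith [Real.pi_lt_d2, Real.pi_pos]
    have h5 : (s + 1 / (2 * s)) * 2 - 1 / s * rexp (-(π ^ 2 / 4 * s ^ 2)) ≤ 5 * s := by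
      have : 1 / s * (1 - π ^ 2 / 4 * s ^ 2) ≤ 1 / s * rexp (-(π ^ 2 / 4 * s ^ 2)) := by
        gcongr; linarith
      have e : (s + 1 / (2 * s)) * 2 - 1 / s * (1 - π ^ 2 / 4 * s ^ 2) =
          (2 + π ^ 2 / 4) * s := by field_simp; ring
      nlinarith
    have h6 : s ≤ s ^ (3 / 4 : ℝ) := by
      conv_lhs => rw [← Real.rpow_one s]
      exact Real.rpow_le_rpow_of_exponent_ge hs0 h1 (by norm_num)
    linarith
  · have : ∫ y, |heat t (y - h) - heat t y| ≤ 2 := by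
      refine (integral_mono ((ii h).sub (integrable_heat ht)).abs ((ii h).add (integrable_heat ht))
        (fun y => ?_)).trans_eq ?_
      · simp only [Pi.add_apply, Pi.sub_apply]
        have h1 := heat_nonneg ht (y - h)
        have h2 := heat_nonneg ht y
        rw [abs_le]
        constructor <;> linarith
      · simp only [Pi.add_apply]
        rw [integral_add (ii h) (integrable_heat ht), iz, integral_heat ht]
        norm_num
    have := Real.one_le_rpow h1 (show (0 : ℝ) ≤ 3 / 4 by norm_num)
    linarith

/-- The Bessel potential of order one: an integrable kernel with Fourier transform `⟨ξ⟩⁻¹`, Hölder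
continuous of order `3/4` in `L¹`. -/
theorem exists_besselKernel : ∃ G : EuclideanSpace ℝ (Fin 3) → ℂ, Measurable G ∧ Integrable G ∧
    (∀ ξ, ∫ y, phase (-y) ξ * G y = (((1 + ‖ξ‖ ^ 2) ^ (-1 / 2 : ℝ) : ℝ) : ℂ)) ∧
    ∃ C : ℝ, 0 ≤ C ∧
      ∀ h, ∫⁻ y, ‖G (y - h) - G y‖ₑ ≤ ENNReal.ofReal (C * ‖h‖ ^ (3 / 4 : ℝ)) := by
  set k : ℝ → ℝ := fun t => (√π)⁻¹ * (t ^ (-1 / 2 : ℝ) * rexp (-t)) with hk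
  have hk0 : ∀ t, 0 < t → 0 ≤ k t := fun t ht => by positivity
  set m : Measure ℝ := volume.restrict (Set.Ioi 0) with hm
  have hheat : Measurable fun p : ℝ × EuclideanSpace ℝ (Fin 3) => heat p.1 p.2 := by
    unfold heat; fun_prop
  have hkm : Measurable k := by fun_prop
  have hkh : Measurable fun p : ℝ × EuclideanSpace ℝ (Fin 3) => k p.1 * heat p.1 p.2 :=
    (hkm.comp measurable_fst).mul hheat
  have hK : ∀ q : ℝ, q < 1 / 2 → Integrable (fun t => k t * t ^ (-q)) m := by
    intro q hq
    have := (integrableOn_rpow_mul_exp_neg_mul (a := 1 / 2 - q) (r := 1) (by linarith)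
        (by norm_num)).const_mul ((√π)⁻¹)
    refine this.congr ?_
    filter_upwards [ae_restrict_mem measurableSet_Ioi] with t ht
    have ht : 0 < t := ht
    rw [hk, show 1 / 2 - q - 1 = -1 / 2 + -q by ring, Real.rpow_add ht, one_mul]
    ring
  have hint : Integrable (fun p : ℝ × EuclideanSpace ℝ (Fin 3) => ((k p.1 * heat p.1 p.2 : ℝ) : ℂ))
      (m.prod volume) := by
    suffices Integrable (fun p : ℝ × EuclideanSpace ℝ (Fin 3) => k p.1 * heat p.1 p.2)
      (m.prod volume) from this.ofReal
    rw [integrable_prod_iff hkh.aestronglyMeasurable]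
    constructor
    · filter_upwards [ae_restrict_mem measurableSet_Ioi] with t ht
      exact (integrable_heat ht).const_mul _
    · refine (hK 0 (by norm_num)).congr ?_
      filter_upwards [ae_restrict_mem measurableSet_Ioi] with t ht
      have ht : 0 < t := ht
      have : ∀ y, ‖k t * heat t y‖ = k t * heat t y := fun y =>
        Real.norm_of_nonneg (mul_nonneg (hk0 t ht) (heat_nonneg ht y))
      simp_rw [this]
      rw [integral_const_mul, integral_heat ht]
      simp
  set G : EuclideanSpace ℝ (Fin 3) → ℂ := fun y => ∫ t, ((k t * heat t y : ℝ) : ℂ) ∂m with hG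
  have hGm : Measurable G := by
    have : StronglyMeasurable (Function.uncurry fun (y : EuclideanSpace ℝ (Fin 3)) (t : ℝ) =>
        ((k t * heat t y : ℝ) : ℂ)) := by
      exact (Complex.measurable_ofReal.comp (hkh.comp measurable_swap)).stronglyMeasurable
    exact (this.integral_prod_right (ν := m)).measurable
  refine ⟨G, hGm, hint.integral_prod_right, ?_, ?_⟩
  · intro ξ
    have e : ∀ y, phase (-y) ξ * G y = ∫ t, phase (-y) ξ * ((k t * heat t y : ℝ) : ℂ) ∂m :=
      fun y => (integral_const_mul _ _).symm
    simp_rw [e]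
    have hint2 : Integrable (fun p : ℝ × EuclideanSpace ℝ (Fin 3) =>
        phase (-p.2) ξ * ((k p.1 * heat p.1 p.2 : ℝ) : ℂ)) (m.prod volume) := by
      refine hint.bdd_mul (c := 1) ?_ (ae_of_all _ fun p => (norm_phase _ _).le)
      exact (Continuous.phase (by fun_prop) continuous_const).aestronglyMeasurable
    rw [← integral_integral_swap hint2]
    have e2 : ∀ t ∈ Set.Ioi (0 : ℝ), ∫ y, phase (-y) ξ * ((k t * heat t y : ℝ) : ℂ) =
        (((√π)⁻¹ * (t ^ (-1 / 2 : ℝ) * rexp (-((1 + ‖ξ‖ ^ 2) * t))) : ℝ) : ℂ) := by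
      intro t ht
      have : ∀ y, phase (-y) ξ * ((k t * heat t y : ℝ) : ℂ) =
          (k t : ℂ) * (phase (-y) ξ * (heat t y : ℂ)) := fun y => by push_cast; ring
      simp_rw [this]
      rw [integral_const_mul, integral_phase_mul_heat ht, ← Complex.ofReal_mul, hk]
      congr 1
      rw [show -((1 + ‖ξ‖ ^ 2) * t) = -t + -(t * ‖ξ‖ ^ 2) by ring, Real.exp_add]
      ring
    rw [hm, setIntegral_congr_fun measurableSet_Ioi e2, integral_complex_ofReal,
      integral_const_mul, integral_rpow_neg_half_mul_exp (by positivity), ← mul_assoc,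
      inv_mul_cancel₀ (by positivity), one_mul]
  · refine ⟨5 * ∫ t, k t * t ^ (-(3 / 8) : ℝ) ∂m, ?_, ?_⟩
    · refine mul_nonneg (by norm_num) (integral_nonneg_of_ae ?_)
      filter_upwards [ae_restrict_mem measurableSet_Ioi] with t ht
      have ht : 0 < t := ht
      exact mul_nonneg (hk0 t ht) (by positivity)
    intro h
    have ae1 := hint.prod_left_ae
    have ae2 := (measurePreserving_sub_right volume h).quasiMeasurePreserving.ae ae1
    calc ∫⁻ y, ‖G (y - h) - G y‖ₑ
        ≤ ∫⁻ y, ∫⁻ t, ENNReal.ofReal (k t) * ‖heat t (y - h) - heat t y‖ₑ ∂m := by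
          refine lintegral_mono_ae ?_
          filter_upwards [ae1, ae2] with y h1 h2
          rw [hG, ← integral_sub h2 h1]
          refine (enorm_integral_le_lintegral_enorm _).trans (lintegral_mono_ae ?_)
          filter_upwards [ae_restrict_mem measurableSet_Ioi] with t ht
          rw [← Complex.ofReal_sub, ← mul_sub, Complex.ofReal_mul, enorm_mul]
          rw [← ofReal_norm, ← ofReal_norm, Complex.norm_real, Complex.norm_real,
            Real.norm_of_nonneg (hk0 t ht), ofReal_norm]
      _ = ∫⁻ t, (∫⁻ y, ENNReal.ofReal (k t) * ‖heat t (y - h) - heat t y‖ₑ) ∂m := by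
          refine lintegral_lintegral_swap (Measurable.aemeasurable ?_)
          have h1 := hheat.comp measurable_swap
          have h2 := h1.comp (show Measurable fun p : EuclideanSpace ℝ (Fin 3) × ℝ =>
            (p.1 - h, p.2) by fun_prop)
          simp only [Function.comp_def, Prod.fst_swap, Prod.snd_swap] at h1 h2
          unfold Function.uncurry
          fun_prop
      _ ≤ ∫⁻ t, ENNReal.ofReal (5 * ‖h‖ ^ (3 / 4 : ℝ) * (k t * t ^ (-(3 / 8) : ℝ))) ∂m := by
          refine lintegral_mono_ae ?_
          filter_upwards [ae_restrict_mem measurableSet_Ioi] with t ht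
          have ht' : 0 < t := ht
          have i : Integrable fun y : EuclideanSpace ℝ (Fin 3) =>
              heat t (y - h) - heat t y :=
            ((integrable_heat ht).comp_sub_right h).sub (integrable_heat ht)
          rw [lintegral_const_mul' _ _ ENNReal.ofReal_ne_top,
            ← ofReal_integral_norm_eq_lintegral_enorm i, ← ENNReal.ofReal_mul (hk0 t ht)]
          refine ENNReal.ofReal_le_ofReal ?_
          simp_rw [Real.norm_eq_abs]
          refine (mul_le_mul_of_nonneg_left (integral_abs_heat_sub_le ht h) (hk0 t ht)).trans_eq ?_
          rw [Real.div_rpow (by positivity) (by positivity), Real.sqrt_eq_rpow,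
            ← Real.rpow_mul ht'.le, Real.rpow_neg ht'.le]
          norm_num
          ring
      _ = ENNReal.ofReal ((5 * ∫ t, k t * t ^ (-(3 / 8) : ℝ) ∂m) * ‖h‖ ^ (3 / 4 : ℝ)) := by
          rw [← ofReal_integral_eq_lintegral_ofReal ((hK _ (by norm_num)).const_mul _),
            integral_const_mul]
          · congr 1; ring
          · filter_upwards [ae_restrict_mem measurableSet_Ioi] with t ht
            have ht' : 0 < t := ht
            have := hk0 t ht
            simp only [Pi.zero_apply]
            positivity
theorem fourierInv_eq_integral_phase (A : EuclideanSpace ℝ (Fin 3) → ℂ)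
    (x : EuclideanSpace ℝ (Fin 3)) : 𝓕⁻ A x = ∫ ξ, phase x ξ * A ξ := by
  rw [Real.fourierInv_eq']
  simp_rw [phase, real_inner_comm x, smul_eq_mul]

theorem measurable_phase_comp {P : Type*} [MeasurableSpace P] {f g : P → EuclideanSpace ℝ (Fin 3)}
    (hf : Measurable f) (hg : Measurable g) : Measurable fun p => phase (f p) (g p) := by
  unfold phase
  fun_prop

theorem integrable_phase_mul {P : Type*} [MeasurableSpace P] {τ : Measure P}
    {f g : P → EuclideanSpace ℝ (Fin 3)} (hf : Measurable f) (hg : Measurable g) {D : P → ℂ}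
    (hD : Integrable D τ) : Integrable (fun p => phase (f p) (g p) * D p) τ := by
  refine hD.bdd_mul (c := 1) (measurable_phase_comp hf hg).aestronglyMeasurable ?_
  filter_upwards with p
  rw [norm_phase]

theorem norm_fourierInv_le (A : EuclideanSpace ℝ (Fin 3) → ℂ)
    (x : EuclideanSpace ℝ (Fin 3)) : ‖𝓕⁻ A x‖ ≤ ∫ ξ, ‖A ξ‖ := by
  rw [fourierInv_eq_integral_phase]
  refine (norm_integral_le_integral_norm _).trans_eq ?_
  simp_rw [norm_mul, norm_phase, one_mul]

theorem continuous_fourierInv {A : EuclideanSpace ℝ (Fin 3) → ℂ} (hA : Integrable A) :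
    Continuous (𝓕⁻ A) := by
  have : 𝓕⁻ A = fun x => ∫ ξ, phase x ξ * A ξ := funext (fourierInv_eq_integral_phase A)
  rw [this]
  refine continuous_of_dominated (bound := fun ξ => ‖A ξ‖) ?_ ?_ hA.norm ?_
  · exact fun x => (integrable_phase_mul measurable_const measurable_id hA).aestronglyMeasurable
  · intro x
    filter_upwards with ξ
    rw [norm_mul, norm_phase, one_mul]
  · filter_upwards with ξ
    exact (continuous_id.phase continuous_const).mul continuous_const

/-- The product of two inverse Fourier transforms as a double oscillatory integral. -/
theorem fourierInv_mul_fourierInv (A B : EuclideanSpace ℝ (Fin 3) → ℂ)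
    (x : EuclideanSpace ℝ (Fin 3)) :
    𝓕⁻ A x * 𝓕⁻ B x = ∫ p : EuclideanSpace ℝ (Fin 3) × EuclideanSpace ℝ (Fin 3),
      phase x (p.1 + p.2) * (A p.1 * B p.2) := by
  rw [fourierInv_eq_integral_phase, fourierInv_eq_integral_phase, ← integral_prod_mul]
  congr 1 with p
  rw [phase_add_right]
  ring

theorem integral_mul_integral_phase {P : Type*} [MeasurableSpace P] {τ : Measure P} [SFinite τ]
    {Ξ : P → EuclideanSpace ℝ (Fin 3)} (hΞ : Measurable Ξ) {D : P → ℂ} (hD : Integrable D τ)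
    {k : EuclideanSpace ℝ (Fin 3) → ℂ} (hk : Integrable k) (x : EuclideanSpace ℝ (Fin 3)) :
    ∫ y, k y * ∫ p, phase (x - y) (Ξ p) * D p ∂τ =
      ∫ p, (∫ y, phase (-y) (Ξ p) * k y) * (phase x (Ξ p) * D p) ∂τ := by
  simp_rw [← integral_const_mul, ← integral_mul_const]
  rw [integral_integral_swap]
  · congr 1 with p
    congr 1 with y
    rw [sub_eq_add_neg, phase_add_left]
    ring
  · have h := integrable_phase_mul (f := fun z : EuclideanSpace ℝ (Fin 3) × P => x - z.1)
      (g := fun z => Ξ z.2) (by fun_prop) (by fun_prop) (hk.mul_prod hD)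
    refine h.congr (ae_of_all _ fun z => ?_)
    simp only [Function.uncurry]
    ring

theorem integral_mul_fourierInv {A k : EuclideanSpace ℝ (Fin 3) → ℂ} (hA : Integrable A)
    (hk : Integrable k) (x : EuclideanSpace ℝ (Fin 3)) :
    ∫ y, k y * 𝓕⁻ A (x - y) = 𝓕⁻ (fun ξ => (∫ y, phase (-y) ξ * k y) * A ξ) x := by
  simp_rw [fourierInv_eq_integral_phase]
  refine (integral_mul_integral_phase (Ξ := fun ξ => ξ) measurable_id hA hk x).trans ?_
  congr 1 with ξ
  ring

theorem integral_mul_fourierInv_mul {A B k : EuclideanSpace ℝ (Fin 3) → ℂ} (hA : Integrable A)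
    (hB : Integrable B) (hk : Integrable k) (x : EuclideanSpace ℝ (Fin 3)) :
    ∫ y, k y * (𝓕⁻ A (x - y) * 𝓕⁻ B (x - y)) =
      ∫ p : EuclideanSpace ℝ (Fin 3) × EuclideanSpace ℝ (Fin 3),
        (∫ y, phase (-y) (p.1 + p.2) * k y) * (phase x (p.1 + p.2) * (A p.1 * B p.2)) := by
  simp_rw [fourierInv_mul_fourierInv]
  exact integral_mul_integral_phase
    (Ξ := fun p : EuclideanSpace ℝ (Fin 3) × EuclideanSpace ℝ (Fin 3) => p.1 + p.2)
    (D := fun p => A p.1 * B p.2) (by fun_prop) (hA.mul_prod hB) hk x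

theorem continuous_integral_mul_comp_sub {k F : EuclideanSpace ℝ (Fin 3) → ℂ} (hk : Integrable k)
    (hF : Continuous F) {M : ℝ} (hM : ∀ x, ‖F x‖ ≤ M) :
    Continuous fun x => ∫ y, k y * F (x - y) := by
  refine continuous_of_dominated (bound := fun y => ‖k y‖ * M) ?_ ?_ (hk.norm.mul_const M) ?_
  · intro x
    have : Continuous fun y => F (x - y) := by fun_prop
    exact hk.aestronglyMeasurable.mul this.aestronglyMeasurable
  · intro x
    filter_upwards with y
    rw [norm_mul]
    gcongr
    exact hM _
  · filter_upwards with y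
    fun_prop

theorem eLpNorm_comp_sub (F : EuclideanSpace ℝ (Fin 3) → ℂ) (hF : Measurable F) (p : ℝ≥0∞)
    (y : EuclideanSpace ℝ (Fin 3)) :
    eLpNorm (fun x => F (x - y)) p volume = eLpNorm F p volume :=
  eLpNorm_comp_measurePreserving hF.aestronglyMeasurable (measurePreserving_sub_right volume y)

/-- **Young's inequality** `L¹ * L^p ⊆ L^p`. -/
theorem eLpNorm_integral_mul_comp_sub_le {k F : EuclideanSpace ℝ (Fin 3) → ℂ} (hk : Measurable k)
    (hF : Measurable F) {p : ℝ≥0∞} (hp : 1 ≤ p) (hp' : p ≠ ∞) :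
    eLpNorm (fun x => ∫ y, k y * F (x - y)) p volume ≤ (∫⁻ y, ‖k y‖ₑ) * eLpNorm F p volume := by
  refine eLpNorm_le_of_enorm_le_lintegral hp hp' hk (F := fun y x => F (x - y)) ?_
    (fun y => (eLpNorm_comp_sub F hF p y).le) fun x => ?_
  · exact hF.comp (measurable_snd.sub measurable_fst)
  · refine (enorm_integral_le_lintegral_enorm _).trans_eq ?_
    simp_rw [enorm_mul]

theorem eLpNorm_three_half_mul_le {f g : EuclideanSpace ℝ (Fin 3) → ℂ} (hf : Measurable f)
    (hg : Measurable g) : eLpNorm (fun x => f x * g x) (3 / 2) volume ≤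
      eLpNorm f 3 volume * eLpNorm g 3 volume := by
  have : ENNReal.HolderTriple 3 3 (3 / 2) := by
    refine ⟨?_⟩
    rw [ENNReal.inv_div (by simp) (by simp), ← two_mul, ENNReal.div_eq_inv_mul, mul_comm]
  exact eLpNorm_smul_le_mul_eLpNorm (φ := f) (f := g) hg.aestronglyMeasurable
    hf.aestronglyMeasurable

/-- The Japanese bracket `⟨ξ⟩`. -/
noncomputable def bracket (ξ : EuclideanSpace ℝ (Fin 3)) : ℝ := (1 + ‖ξ‖ ^ 2) ^ (1 / 2 : ℝ)

theorem bracket_eq_sqrt (ξ : EuclideanSpace ℝ (Fin 3)) : bracket ξ = √(1 + ‖ξ‖ ^ 2) := by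
  rw [bracket, Real.sqrt_eq_rpow]

theorem one_le_bracket (ξ : EuclideanSpace ℝ (Fin 3)) : 1 ≤ bracket ξ := by
  rw [bracket_eq_sqrt, Real.one_le_sqrt]
  nlinarith [sq_nonneg ‖ξ‖]

theorem norm_le_bracket (ξ : EuclideanSpace ℝ (Fin 3)) : ‖ξ‖ ≤ bracket ξ := by
  rw [bracket_eq_sqrt]
  exact Real.le_sqrt_of_sq_le (by linarith)

theorem bracket_le (ξ : EuclideanSpace ℝ (Fin 3)) : bracket ξ ≤ 1 + ‖ξ‖ := by
  rw [bracket_eq_sqrt]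
  exact Real.sqrt_le_iff.2 ⟨by positivity, by nlinarith [norm_nonneg ξ]⟩

theorem bracket_pos (ξ : EuclideanSpace ℝ (Fin 3)) : 0 < bracket ξ :=
  zero_lt_one.trans_le (one_le_bracket ξ)

theorem rpow_neg_half_eq_inv_bracket (ξ : EuclideanSpace ℝ (Fin 3)) :
    (1 + ‖ξ‖ ^ 2) ^ (-1 / 2 : ℝ) = (bracket ξ)⁻¹ := by
  rw [bracket, ← Real.rpow_neg (by positivity)]
  norm_num

theorem continuous_bracket : Continuous bracket := by
  have : bracket = fun ξ => √(1 + ‖ξ‖ ^ 2) := funext bracket_eq_sqrt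
  rw [this]
  fun_prop

theorem integrable_inv_bracket_mul {P : Type*} [MeasurableSpace P] {τ : Measure P}
    {Ξ : P → EuclideanSpace ℝ (Fin 3)} (hΞ : Measurable Ξ) {D : P → ℂ} (hD : Integrable D τ) :
    Integrable (fun p => ((bracket (Ξ p) : ℂ))⁻¹ * D p) τ := by
  have hm : Measurable fun p => ((bracket (Ξ p) : ℂ))⁻¹ :=
    (Complex.measurable_ofReal.comp (continuous_bracket.measurable.comp hΞ)).inv
  refine hD.bdd_mul (c := 1) hm.aestronglyMeasurable ?_
  filter_upwards with p
  rw [norm_inv, Complex.norm_real, Real.norm_of_nonneg (bracket_pos _).le]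
  exact inv_le_one_of_one_le₀ (one_le_bracket _)

theorem integral_phase_mul_translate_sub {G : EuclideanSpace ℝ (Fin 3) → ℂ} (hG : Integrable G)
    (h ξ : EuclideanSpace ℝ (Fin 3)) :
    ∫ y, phase (-y) ξ * (G (y - h) - G y) = (phase (-h) ξ - 1) * ∫ y, phase (-y) ξ * G y := by
  have i0 : Integrable fun y => phase (-y) ξ * G y :=
    integrable_phase_mul (by fun_prop) (by fun_prop) hG
  have i1 : Integrable fun y => phase (-y) ξ * G (y - h) :=
    integrable_phase_mul (by fun_prop) (by fun_prop) (hG.comp_sub_right h)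
  have e : ∀ y, phase (-y) ξ * G (y - h) = phase (-h) ξ * (phase (-(y - h)) ξ * G (y - h)) := by
    intro y
    rw [← mul_assoc, ← phase_add_left]
    congr 2
    abel
  simp_rw [mul_sub]
  rw [integral_sub i1 i0, sub_mul, one_mul]
  congr 1
  simp_rw [e]
  rw [integral_const_mul, integral_sub_right_eq_self (fun y => phase (-y) ξ * G y) h]

theorem fourierInv_phase_sub_one_mul {a : EuclideanSpace ℝ (Fin 3) → ℂ} (ha : Integrable a)
    (h z : EuclideanSpace ℝ (Fin 3)) :
    𝓕⁻ (fun ξ => (phase h ξ - 1) * a ξ) z = 𝓕⁻ a (z + h) - 𝓕⁻ a z := by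
  simp_rw [fourierInv_eq_integral_phase]
  rw [← integral_sub]
  · congr 1 with ξ
    rw [phase_add_left]
    ring
  · exact integrable_phase_mul measurable_const measurable_id ha
  · exact integrable_phase_mul measurable_const measurable_id ha

theorem integrable_phase_sub_one_mul {a : EuclideanSpace ℝ (Fin 3) → ℂ} (ha : Integrable a)
    (h : EuclideanSpace ℝ (Fin 3)) : Integrable fun ξ => (phase h ξ - 1) * a ξ := by
  have := (integrable_phase_mul (f := fun _ => h) measurable_const measurable_id ha).sub ha
  refine this.congr (ae_of_all _ fun ξ => ?_)
  simp only [Pi.sub_apply, id]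
  ring

theorem norm_phase_sub_one_mul_le (h ξ η : EuclideanSpace ℝ (Fin 3)) :
    ‖(phase (-h) ξ - 1) * (bracket ξ : ℂ)⁻¹ * (phase h η - 1)‖ ≤
      (2 * π) ^ 2 * (‖h‖ ^ (2 : ℝ) * bracket η) := by
  have h1 := norm_one_sub_phase_le (-h) ξ
  have h2 := norm_one_sub_phase_le h η
  rw [norm_sub_rev, norm_neg] at h1
  rw [norm_sub_rev] at h2
  have hb := bracket_pos ξ
  rw [norm_mul, norm_mul, norm_inv, Complex.norm_real, Real.norm_of_nonneg hb.le,
    Real.rpow_two]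
  have h3 : ‖ξ‖ * (bracket ξ)⁻¹ ≤ 1 := by
    rw [mul_inv_le_iff₀ hb, one_mul]
    exact norm_le_bracket ξ
  calc _ ≤ 2 * π * (‖h‖ * ‖ξ‖) * (bracket ξ)⁻¹ * (2 * π * (‖h‖ * bracket η)) := by
        gcongr
        exact h2.trans (by gcongr; exact norm_le_bracket η)
    _ = (2 * π) ^ 2 * (‖h‖ ^ 2 * bracket η) * (‖ξ‖ * (bracket ξ)⁻¹) := by ring
    _ ≤ _ := mul_le_of_le_one_right (by have := bracket_pos η; positivity) h3

/-- The commutator identity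
`⟨∇⟩⁻¹(f ⟨∇⟩v) = ⟨∇⟩⁻¹(v ⟨∇⟩f) + f v - ⟨∇⟩⁻¹(f v) - R` with `R` given by the carré du champ. -/
theorem commutator_identity {G : EuclideanSpace ℝ (Fin 3) → ℂ} (hG : Integrable G)
    (hGF : ∀ ξ, ∫ y, phase (-y) ξ * G y = (bracket ξ : ℂ)⁻¹)
    {μ : Measure (EuclideanSpace ℝ (Fin 3))} [SFinite μ]
    (hμ2 : Integrable (fun h => ‖h‖ ^ (2 : ℝ)) μ)
    (hμ : ∀ ξ η, ∫ h, (1 - phase (-h) ξ) * (1 - phase h η) ∂μ =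
      ((bracket ξ + bracket η - bracket (ξ - η) - 1 : ℝ) : ℂ))
    {a b : EuclideanSpace ℝ (Fin 3) → ℂ} (ha : Integrable a) (hb : Integrable b)
    (hwa : Integrable fun ξ => (bracket ξ : ℂ) * a ξ)
    (hwb : Integrable fun ξ => (bracket ξ : ℂ) * b ξ) (x : EuclideanSpace ℝ (Fin 3)) :
    ∫ h, (∫ y, (G (y - h) - G y) * ((𝓕⁻ a (x - y + h) - 𝓕⁻ a (x - y)) * 𝓕⁻ b (x - y))) ∂μ =
      (∫ y, G y * (𝓕⁻ (fun ξ => (bracket ξ : ℂ) * a ξ) (x - y) * 𝓕⁻ b (x - y)))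
        + 𝓕⁻ a x * 𝓕⁻ b x - (∫ y, G y * (𝓕⁻ a (x - y) * 𝓕⁻ b (x - y)))
        - ∫ y, G y * (𝓕⁻ a (x - y) * 𝓕⁻ (fun ξ => (bracket ξ : ℂ) * b ξ) (x - y)) := by
  set D : EuclideanSpace ℝ (Fin 3) × EuclideanSpace ℝ (Fin 3) → ℂ :=
    fun p => phase x (p.1 + p.2) * (a p.1 * b p.2) with hD
  have hDi : Integrable D (volume.prod volume) :=
    integrable_phase_mul measurable_const (by fun_prop) (ha.mul_prod hb)
  have hDa : Integrable (fun p : EuclideanSpace ℝ (Fin 3) × EuclideanSpace ℝ (Fin 3) =>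
      (bracket p.1 : ℂ) * D p) (volume.prod volume) := by
    refine (integrable_phase_mul (f := fun _ => x) (g := fun p => p.1 + p.2) measurable_const
      (by fun_prop) (hwa.mul_prod hb)).congr (ae_of_all _ fun p => ?_)
    simp only [hD]
    ring
  have hDb : Integrable (fun p : EuclideanSpace ℝ (Fin 3) × EuclideanSpace ℝ (Fin 3) =>
      (bracket p.2 : ℂ) * D p) (volume.prod volume) := by
    refine (integrable_phase_mul (f := fun _ => x) (g := fun p => p.1 + p.2) measurable_const
      (by fun_prop) (ha.mul_prod hwb)).congr (ae_of_all _ fun p => ?_)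
    simp only [hD]
    ring
  have hinner : ∀ h, ∫ y, (G (y - h) - G y) *
      ((𝓕⁻ a (x - y + h) - 𝓕⁻ a (x - y)) * 𝓕⁻ b (x - y)) =
      ∫ p, ((phase (-h) (p.1 + p.2) - 1) * (bracket (p.1 + p.2) : ℂ)⁻¹ * (phase h p.1 - 1)) * D p
        ∂(volume.prod volume) := by
    intro h
    simp_rw [← fourierInv_phase_sub_one_mul ha]
    have hk : Integrable fun y => G (y - h) - G y := (hG.comp_sub_right h).sub hG
    rw [integral_mul_fourierInv_mul (integrable_phase_sub_one_mul ha h) hb hk]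
    refine integral_congr_ae (ae_of_all _ fun p => ?_)
    simp only
    rw [integral_phase_mul_translate_sub hG, hGF]
    simp only [hD]
    ring
  simp_rw [hinner]
  rw [integral_integral_swap]
  · have hμp : ∀ p : EuclideanSpace ℝ (Fin 3) × EuclideanSpace ℝ (Fin 3),
        ∫ h, ((phase (-h) (p.1 + p.2) - 1) * (bracket (p.1 + p.2) : ℂ)⁻¹ * (phase h p.1 - 1)) * D p
          ∂μ = (bracket (p.1 + p.2) : ℂ)⁻¹ * ((bracket p.1 : ℂ) * D p) + D p
            - (bracket (p.1 + p.2) : ℂ)⁻¹ * D p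
            - (bracket (p.1 + p.2) : ℂ)⁻¹ * ((bracket p.2 : ℂ) * D p) := by
      intro p
      have e : ∀ h, ((phase (-h) (p.1 + p.2) - 1) * (bracket (p.1 + p.2) : ℂ)⁻¹ *
          (phase h p.1 - 1)) * D p = ((1 - phase (-h) (p.1 + p.2)) * (1 - phase h p.1)) *
            ((bracket (p.1 + p.2) : ℂ)⁻¹ * D p) := by
        intro h; ring
      simp_rw [e]
      rw [integral_mul_const, hμ, add_sub_cancel_left]
      have hne : (bracket (p.1 + p.2) : ℂ) ≠ 0 := by
        exact_mod_cast (bracket_pos (p.1 + p.2)).ne'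
      push_cast
      field_simp
      ring
    simp_rw [hμp]
    have hm : Measurable fun p : EuclideanSpace ℝ (Fin 3) × EuclideanSpace ℝ (Fin 3) =>
      p.1 + p.2 := by fun_prop
    have i1 := integrable_inv_bracket_mul hm hDa
    have i3 := integrable_inv_bracket_mul hm hDi
    have i4 := integrable_inv_bracket_mul hm hDb
    have i12 : Integrable (fun p : EuclideanSpace ℝ (Fin 3) × EuclideanSpace ℝ (Fin 3) =>
      (bracket (p.1 + p.2) : ℂ)⁻¹ * ((bracket p.1 : ℂ) * D p) + D p) (volume.prod volume) :=
      i1.add hDi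
    have i123 : Integrable (fun p : EuclideanSpace ℝ (Fin 3) × EuclideanSpace ℝ (Fin 3) =>
      (bracket (p.1 + p.2) : ℂ)⁻¹ * ((bracket p.1 : ℂ) * D p) + D p
        - (bracket (p.1 + p.2) : ℂ)⁻¹ * D p) (volume.prod volume) := i12.sub i3
    rw [integral_sub i123 i4, integral_sub i12 i3, integral_add i1 hDi,
      integral_mul_fourierInv_mul hwa hb hG, integral_mul_fourierInv_mul ha hb hG,
      integral_mul_fourierInv_mul ha hwb hG, fourierInv_mul_fourierInv]
    simp_rw [hGF]
    congr 1
    · congr 2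
      refine integral_congr_ae (ae_of_all _ fun p => ?_)
      simp only [hD]
      ring
    · refine integral_congr_ae (ae_of_all _ fun p => ?_)
      simp only [hD]
      ring
  · have hbound := (hμ2.mul_prod hDa.norm).const_mul ((2 * π) ^ 2)
    refine hbound.mono' ?_ (ae_of_all _ fun z => ?_)
    · have hp1 : Measurable fun z : EuclideanSpace ℝ (Fin 3) ×
          (EuclideanSpace ℝ (Fin 3) × EuclideanSpace ℝ (Fin 3)) =>
          (phase (-z.1) (z.2.1 + z.2.2) - 1) * (bracket (z.2.1 + z.2.2) : ℂ)⁻¹ *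
            (phase z.1 z.2.1 - 1) := by
        have hb1 : Measurable fun z : EuclideanSpace ℝ (Fin 3) ×
          (EuclideanSpace ℝ (Fin 3) × EuclideanSpace ℝ (Fin 3)) => bracket (z.2.1 + z.2.2) :=
            continuous_bracket.measurable.comp (by fun_prop)
        have hq1 : Measurable fun z : EuclideanSpace ℝ (Fin 3) ×
          (EuclideanSpace ℝ (Fin 3) × EuclideanSpace ℝ (Fin 3)) =>
            phase (-z.1) (z.2.1 + z.2.2) := measurable_phase_comp (by fun_prop) (by fun_prop)
        have hq2 : Measurable fun z : EuclideanSpace ℝ (Fin 3) ×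
          (EuclideanSpace ℝ (Fin 3) × EuclideanSpace ℝ (Fin 3)) =>
            phase z.1 z.2.1 := measurable_phase_comp (by fun_prop) (by fun_prop)
        fun_prop
      exact hp1.aestronglyMeasurable.mul hDi.aestronglyMeasurable.comp_snd
    · obtain ⟨h, p⟩ := z
      simp only [Function.uncurry]
      have hk := norm_phase_sub_one_mul_le h (p.1 + p.2) p.1
      rw [norm_mul, norm_mul (bracket p.1 : ℂ), Complex.norm_real,
        Real.norm_of_nonneg (bracket_pos _).le]
      refine (mul_le_mul_of_nonneg_right hk (norm_nonneg _)).trans_eq ?_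
      ring

/-- The `L^{3/2}` bound for the remainder in `commutator_identity`. -/
theorem eLpNorm_remainder_le {G : EuclideanSpace ℝ (Fin 3) → ℂ} (hGm : Measurable G) {C : ℝ}
    (hC : 0 ≤ C)
    (hGC : ∀ h, ∫⁻ y, ‖G (y - h) - G y‖ₑ ≤ ENNReal.ofReal (C * ‖h‖ ^ (3 / 4 : ℝ)))
    (μ : Measure (EuclideanSpace ℝ (Fin 3))) [SFinite μ]
    {f u v : EuclideanSpace ℝ (Fin 3) → ℂ} (hf : Measurable f) (hu : Measurable u)
    (hv : Measurable v)
    (hfu : ∀ h x, f (x + h) - f x = ∫ y, (G (y + h) - G y) * u (x - y)) :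
    eLpNorm (fun x => ∫ h, (∫ y, (G (y - h) - G y) *
        ((f (x - y + h) - f (x - y)) * v (x - y))) ∂μ) (3 / 2) volume ≤
      ENNReal.ofReal C * ENNReal.ofReal C * (∫⁻ h, ENNReal.ofReal (‖h‖ ^ (3 / 2 : ℝ)) ∂μ) *
        (eLpNorm u 3 volume * eLpNorm v 3 volume) := by
  have hδ : ∀ h, eLpNorm (fun x => f (x + h) - f x) 3 volume ≤
      ENNReal.ofReal (C * ‖h‖ ^ (3 / 4 : ℝ)) * eLpNorm u 3 volume := by
    intro h
    simp_rw [hfu]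
    refine (eLpNorm_integral_mul_comp_sub_le (k := fun y => G (y + h) - G y) (by fun_prop) hu
      (by norm_num) (by simp)).trans ?_
    gcongr
    simpa using hGC (-h)
  have hδv : ∀ h y, eLpNorm (fun x => (f (x - y + h) - f (x - y)) * v (x - y)) (3 / 2) volume ≤
      ENNReal.ofReal (C * ‖h‖ ^ (3 / 4 : ℝ)) * (eLpNorm u 3 volume * eLpNorm v 3 volume) := by
    intro h y
    rw [eLpNorm_comp_sub (fun x => (f (x + h) - f x) * v x) (by fun_prop), ← mul_assoc]
    refine (eLpNorm_three_half_mul_le (f := fun x => f (x + h) - f x) (by fun_prop) hv).trans ?_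
    gcongr
    exact hδ h
  have key := eLpNorm_le_of_enorm_le_lintegral (ν := μ.prod volume)
    (μ := (volume : Measure (EuclideanSpace ℝ (Fin 3)))) (p := 3 / 2)
    (by rw [ENNReal.le_div_iff_mul_le (by simp) (by simp)]; norm_num)
    (ENNReal.div_ne_top (by simp) (by simp))
    (c := fun a => ((‖a.1‖ ^ (3 / 4 : ℝ) : ℝ) : ℂ) * (G (a.2 - a.1) - G a.2)) (by fun_prop)
    (F := fun a x => (((‖a.1‖ ^ (3 / 4 : ℝ))⁻¹ : ℝ) : ℂ) *
      ((f (x - a.2 + a.1) - f (x - a.2)) * v (x - a.2)))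
    (B := ENNReal.ofReal C * (eLpNorm u 3 volume * eLpNorm v 3 volume))
    (Φ := fun x => ∫ h, (∫ y, (G (y - h) - G y) *
        ((f (x - y + h) - f (x - y)) * v (x - y))) ∂μ) ?_ ?_ ?_
  · refine key.trans ?_
    rw [lintegral_prod _ (Measurable.aemeasurable (by fun_prop))]
    calc _ ≤ (∫⁻ h, ENNReal.ofReal C * ENNReal.ofReal (‖h‖ ^ (3 / 2 : ℝ)) ∂μ) *
            (ENNReal.ofReal C * (eLpNorm u 3 volume * eLpNorm v 3 volume)) := by
          gcongr with h
          simp_rw [enorm_mul]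
          rw [lintegral_const_mul _ (by fun_prop)]
          calc _ ≤ ENNReal.ofReal (‖h‖ ^ (3 / 4 : ℝ)) *
                  ENNReal.ofReal (C * ‖h‖ ^ (3 / 4 : ℝ)) := by
                gcongr
                · rw [← ofReal_norm, Complex.norm_real,
                    Real.norm_of_nonneg (by positivity)]
                · exact hGC h
            _ = _ := by
                rw [← ENNReal.ofReal_mul (by positivity), ← ENNReal.ofReal_mul hC]
                congr 1
                have : ‖h‖ ^ (3 / 2 : ℝ) = ‖h‖ ^ (3 / 4 : ℝ) * ‖h‖ ^ (3 / 4 : ℝ) := by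
                  rw [← Real.rpow_add_of_nonneg (norm_nonneg h) (by norm_num) (by norm_num)]
                  norm_num
                rw [this]
                ring
      _ = _ := by
          rw [lintegral_const_mul _ (by fun_prop)]
          ring
  · unfold Function.uncurry
    fun_prop
  · rintro ⟨h, y⟩
    refine (eLpNorm_const_smul_le (c := (((‖h‖ ^ (3 / 4 : ℝ))⁻¹ : ℝ) : ℂ))
      (f := fun x => (f (x - y + h) - f (x - y)) * v (x - y))).trans ?_
    refine (mul_le_mul_right (hδv h y) _).trans ?_
    rw [← mul_assoc]
    gcongr
    rw [← ofReal_norm, Complex.norm_real, Real.norm_of_nonneg (by positivity),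
      ← ENNReal.ofReal_mul (by positivity)]
    refine ENNReal.ofReal_le_ofReal ?_
    rw [mul_left_comm]
    exact mul_le_of_le_one_right hC inv_mul_le_one
  · intro x
    refine (enorm_integral_le_lintegral_enorm _).trans ?_
    rw [lintegral_prod _ (Measurable.aemeasurable (by fun_prop))]
    refine lintegral_mono fun h => (enorm_integral_le_lintegral_enorm _).trans ?_
    refine lintegral_mono fun y => le_of_eq ?_
    rw [← enorm_mul]
    congr 1
    rcases eq_or_ne h 0 with rfl | hh
    · simp
    · have : ‖h‖ ^ (3 / 4 : ℝ) ≠ 0 := by positivity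
      have : ((‖h‖ ^ (3 / 4 : ℝ) : ℝ) : ℂ) ≠ 0 := by exact_mod_cast this
      rw [Complex.ofReal_inv]
      field_simp

theorem integral_translate_mul_eq_sub {G u f : EuclideanSpace ℝ (Fin 3) → ℂ} (hG : Integrable G)
    (hu : Continuous u) {M : ℝ} (hM : ∀ x, ‖u x‖ ≤ M) (hf : ∀ x, f x = ∫ y, G y * u (x - y))
    (h x : EuclideanSpace ℝ (Fin 3)) :
    f (x + h) - f x = ∫ y, (G (y + h) - G y) * u (x - y) := by
  have hi : ∀ {k : EuclideanSpace ℝ (Fin 3) → ℂ}, Integrable k →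
      Integrable fun y => k y * u (x - y) := by
    intro k hk
    have hc : Continuous fun y => u (x - y) := by fun_prop
    exact hk.mul_bdd hc.aestronglyMeasurable (ae_of_all _ fun y => hM _)
  simp_rw [sub_mul]
  rw [integral_sub (hi (hG.comp_add_right h)) (hi hG), hf, hf,
    ← integral_add_right_eq_self (fun y => G y * u (x + h - y)) h]
  congr 2 with y
  congr 2
  abel

theorem SchwartzMap.integrable_bracket_mul (A : SchwartzMap (EuclideanSpace ℝ (Fin 3)) ℂ) :
    Integrable fun ξ => (bracket ξ : ℂ) * A ξ := by
  have h1 := A.integrable_pow_mul volume 1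
  have h := A.integrable.norm.add h1
  refine h.mono' ?_ (ae_of_all _ fun ξ => ?_)
  · have hc := (Complex.continuous_ofReal.comp continuous_bracket).mul A.continuous
    exact hc.aestronglyMeasurable
  · rw [norm_mul, Complex.norm_real, Real.norm_of_nonneg (bracket_pos _).le]
    refine (mul_le_mul_of_nonneg_right (bracket_le ξ) (norm_nonneg _)).trans_eq ?_
    simp only [Pi.add_apply]
    ring

theorem SchwartzMap.fourierInv_fourier_coe (f : SchwartzMap (EuclideanSpace ℝ (Fin 3)) ℂ) :
    𝓕⁻ (𝓕 (f : EuclideanSpace ℝ (Fin 3) → ℂ)) = f :=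
  f.continuous.fourierInv_fourier_eq f.integrable
    (by rw [← SchwartzMap.fourier_coe]; exact (𝓕 f).integrable)

/-- The product of two Schwartz functions. -/
noncomputable def SchwartzMap.pointwiseMul (f g : SchwartzMap (EuclideanSpace ℝ (Fin 3)) ℂ) :
    SchwartzMap (EuclideanSpace ℝ (Fin 3)) ℂ :=
  SchwartzMap.bilinLeftCLM (ContinuousLinearMap.mul ℝ ℂ) g.hasTemperateGrowth f

theorem SchwartzMap.coe_pointwiseMul (f g : SchwartzMap (EuclideanSpace ℝ (Fin 3)) ℂ) :
    (f.pointwiseMul g : EuclideanSpace ℝ (Fin 3) → ℂ) = fun x => f x * g x := rfl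

theorem fourierInv_inv_bracket_mul_fourier_eq {G : EuclideanSpace ℝ (Fin 3) → ℂ}
    (hG : Integrable G) (hGF : ∀ ξ, ∫ y, phase (-y) ξ * G y = (bracket ξ : ℂ)⁻¹)
    (F : SchwartzMap (EuclideanSpace ℝ (Fin 3)) ℂ) (x : EuclideanSpace ℝ (Fin 3)) :
    𝓕⁻ (fun ξ => (bracket ξ : ℂ)⁻¹ * 𝓕 (F : EuclideanSpace ℝ (Fin 3) → ℂ) ξ) x =
      ∫ y, G y * F (x - y) := by
  have hA : Integrable (𝓕 (F : EuclideanSpace ℝ (Fin 3) → ℂ)) := by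
    rw [← SchwartzMap.fourier_coe]; exact (𝓕 F).integrable
  have h := integral_mul_fourierInv hA hG x
  rw [F.fourierInv_fourier_coe] at h
  simp_rw [h, hGF]

theorem stmt_13 :
    ∃ C : ℝ, 0 < C ∧ ∀ f g : SchwartzMap (EuclideanSpace ℝ (Fin 3)) ℂ,
      besselNorm (-1) (3 / 2) (fun x => f x * g x) ≤
        ENNReal.ofReal C * besselNorm 1 3 f * besselNorm (-1) 3 g := by
  obtain ⟨G, hGm, hG, hGF, C, hC, hGC⟩ := exists_besselKernel
  obtain ⟨μ, hμs, hμ32, hμ2, hμ⟩ := exists_levyMeasure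
  have hGF' : ∀ ξ, ∫ y, phase (-y) ξ * G y = (bracket ξ : ℂ)⁻¹ := by
    intro ξ
    rw [hGF, rpow_neg_half_eq_inv_bracket, Complex.ofReal_inv]
  set I := ∫⁻ y, ‖G y‖ₑ with hI
  set K := I + I + I * I +
    ENNReal.ofReal C * ENNReal.ofReal C * ∫⁻ h, ENNReal.ofReal (‖h‖ ^ (3 / 2 : ℝ)) ∂μ with hK
  have hKtop : K ≠ ∞ := by
    have hI' : I ≠ ∞ := hG.2.ne
    have hM : ∫⁻ h, ENNReal.ofReal (‖h‖ ^ (3 / 2 : ℝ)) ∂μ ≠ ∞ := hμ32.lintegral_lt_top.ne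
    finiteness
  refine ⟨K.toReal + 1, by positivity, fun f g => ?_⟩
  have hKle : K ≤ ENNReal.ofReal (K.toReal + 1) := by
    rw [ENNReal.le_ofReal_iff_toReal_le hKtop (by positivity)]
    linarith
  set a : EuclideanSpace ℝ (Fin 3) → ℂ := 𝓕 (f : EuclideanSpace ℝ (Fin 3) → ℂ) with ha
  set b : EuclideanSpace ℝ (Fin 3) → ℂ :=
    fun ξ => (bracket ξ : ℂ)⁻¹ * 𝓕 (g : EuclideanSpace ℝ (Fin 3) → ℂ) ξ with hb
  set u := 𝓕⁻ (fun ξ => (bracket ξ : ℂ) * a ξ) with hu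
  set v := 𝓕⁻ b with hv
  set W : EuclideanSpace ℝ (Fin 3) → ℂ := fun x => ∫ y, G y * (f (x - y) * g (x - y)) with hW
  have ef : besselNorm 1 3 f = eLpNorm u 3 volume := rfl
  have eg : besselNorm (-1) 3 g = eLpNorm v 3 volume := by
    simp_rw [besselNorm, rpow_neg_half_eq_inv_bracket, Complex.ofReal_inv]
    rfl
  have eW : besselNorm (-1) (3 / 2) (fun x => f x * g x) = eLpNorm W (3 / 2) volume := by
    simp_rw [besselNorm, rpow_neg_half_eq_inv_bracket, Complex.ofReal_inv,
      ← SchwartzMap.coe_pointwiseMul]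
    exact congrArg (fun F => eLpNorm F (3 / 2) volume)
      (funext (fourierInv_inv_bracket_mul_fourier_eq hG hGF' (f.pointwiseMul g)))
  have hai : Integrable a := by
    rw [ha, ← SchwartzMap.fourier_coe]; exact (𝓕 f).integrable
  have hwai : Integrable fun ξ => (bracket ξ : ℂ) * a ξ := by
    rw [ha, ← SchwartzMap.fourier_coe]; exact (𝓕 f).integrable_bracket_mul
  have hgi : Integrable (𝓕 (g : EuclideanSpace ℝ (Fin 3) → ℂ)) := by
    rw [← SchwartzMap.fourier_coe]; exact (𝓕 g).integrable
  have hbi : Integrable b := integrable_inv_bracket_mul (Ξ := fun ξ => ξ) measurable_id hgi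
  have hwb : (fun ξ => (bracket ξ : ℂ) * b ξ) = 𝓕 (g : EuclideanSpace ℝ (Fin 3) → ℂ) := by
    ext ξ
    have : (bracket ξ : ℂ) ≠ 0 := by exact_mod_cast (bracket_pos ξ).ne'
    simp only [hb]
    field_simp
  have hfa : 𝓕⁻ a = f := f.fourierInv_fourier_coe
  have hcu : Continuous u := continuous_fourierInv hwai
  have hcv : Continuous v := continuous_fourierInv hbi
  have hcf : Continuous f := f.continuous
  have hbu := norm_fourierInv_le fun ξ => (bracket ξ : ℂ) * a ξ
  have hbv := norm_fourierInv_le b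
  have hbf := norm_fourierInv_le a
  have hbg := norm_fourierInv_le (𝓕 (g : EuclideanSpace ℝ (Fin 3) → ℂ))
  rw [hfa] at hbf
  rw [g.fourierInv_fourier_coe] at hbg
  have hmul : ∀ {F H : EuclideanSpace ℝ (Fin 3) → ℂ} {M N : ℝ}, (∀ x, ‖F x‖ ≤ M) →
      (∀ x, ‖H x‖ ≤ N) → ∀ x, ‖F x * H x‖ ≤ M * N := by
    intro F H M N hF hH x
    rw [norm_mul]
    exact mul_le_mul (hF x) (hH x) (norm_nonneg _) ((norm_nonneg _).trans (hF x))
  have hffu : ∀ x, f x = ∫ y, G y * u (x - y) := by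
    intro x
    rw [hu, integral_mul_fourierInv hwai hG, ← hfa]
    refine congrArg
      (fun A : EuclideanSpace ℝ (Fin 3) → ℂ => (𝓕⁻ A : EuclideanSpace ℝ (Fin 3) → ℂ) x)
      (funext fun ξ => ?_)
    rw [hGF', inv_mul_cancel_left₀]
    exact_mod_cast (bracket_pos ξ).ne'
  set T₁ : EuclideanSpace ℝ (Fin 3) → ℂ := fun x => ∫ y, G y * (u (x - y) * v (x - y)) with hT₁
  set T₃ : EuclideanSpace ℝ (Fin 3) → ℂ := fun x => ∫ y, G y * (f (x - y) * v (x - y)) with hT₃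
  set R : EuclideanSpace ℝ (Fin 3) → ℂ := fun x => ∫ h, (∫ y, (G (y - h) - G y) *
        ((f (x - y + h) - f (x - y)) * v (x - y))) ∂μ with hR
  have hcT₁ : Continuous T₁ :=
    continuous_integral_mul_comp_sub hG (hcu.mul hcv) (hmul hbu hbv)
  have hcT₃ : Continuous T₃ :=
    continuous_integral_mul_comp_sub hG (hcf.mul hcv) (hmul hbf hbv)
  have hcW : Continuous W :=
    continuous_integral_mul_comp_sub hG (hcf.mul g.continuous) (hmul hbf hbg)
  have hid : ∀ x, R x = T₁ x + f x * v x - T₃ x - W x := by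
    intro x
    have h := commutator_identity hG hGF' hμ2 hμ hai hbi hwai (by rw [hwb]; exact hgi) x
    rw [hwb, g.fourierInv_fourier_coe, hfa] at h
    exact h
  have hcR : Continuous R := by
    rw [funext hid]
    fun_prop
  have hWeq : W = T₁ + (fun x => f x * v x) - T₃ - R := by
    ext x
    simp only [Pi.sub_apply, Pi.add_apply, hid x]
    ring
  have hp : (1 : ℝ≥0∞) ≤ 3 / 2 := by
    rw [ENNReal.le_div_iff_mul_le (by simp) (by simp)]; norm_num
  have hp' : (3 / 2 : ℝ≥0∞) ≠ ∞ := ENNReal.div_ne_top (by simp) (by simp)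
  set U := eLpNorm u 3 volume
  set V := eLpNorm v 3 volume
  have nf : eLpNorm f 3 volume ≤ I * U := by
    rw [show (f : EuclideanSpace ℝ (Fin 3) → ℂ) = _ from funext hffu]
    exact eLpNorm_integral_mul_comp_sub_le hGm hcu.measurable (by norm_num) (by simp)
  have nfv : eLpNorm (fun x => f x * v x) (3 / 2) volume ≤ I * U * V :=
    (eLpNorm_three_half_mul_le hcf.measurable hcv.measurable).trans (by gcongr)
  have nT₁ : eLpNorm T₁ (3 / 2) volume ≤ I * (U * V) :=
    (eLpNorm_integral_mul_comp_sub_le hGm (hcu.mul hcv).measurable hp hp').trans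
      (by gcongr; exact eLpNorm_three_half_mul_le hcu.measurable hcv.measurable)
  have nT₃ : eLpNorm T₃ (3 / 2) volume ≤ I * (I * U * V) :=
    (eLpNorm_integral_mul_comp_sub_le hGm (hcf.mul hcv).measurable hp hp').trans
      (mul_le_mul_right nfv I)
  have nR := eLpNorm_remainder_le hGm hC hGC μ hcf.measurable hcu.measurable hcv.measurable
    (integral_translate_mul_eq_sub hG hcu hbu hffu)
  have hcfv : Continuous fun x => f x * v x := hcf.mul hcv
  rw [ef, eg, eW]
  calc eLpNorm W (3 / 2) volume
      ≤ eLpNorm T₁ (3 / 2) volume + eLpNorm (fun x => f x * v x) (3 / 2) volume +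
          eLpNorm T₃ (3 / 2) volume + eLpNorm R (3 / 2) volume := by
        rw [hWeq]
        refine (eLpNorm_sub_le ((hcT₁.add hcfv).sub hcT₃).aestronglyMeasurable
          hcR.aestronglyMeasurable hp).trans ?_
        gcongr
        refine (eLpNorm_sub_le (hcT₁.add hcfv).aestronglyMeasurable
          hcT₃.aestronglyMeasurable hp).trans ?_
        gcongr
        exact eLpNorm_add_le hcT₁.aestronglyMeasurable hcfv.aestronglyMeasurable hp
    _ ≤ I * (U * V) + I * U * V + I * (I * U * V) + ENNReal.ofReal C * ENNReal.ofReal C *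
          (∫⁻ h, ENNReal.ofReal (‖h‖ ^ (3 / 2 : ℝ)) ∂μ) * (U * V) := by gcongr
    _ = K * U * V := by rw [hK]; ring
    _ ≤ _ := by gcongr
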